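/- arXiv:2111.13487 — 5 statements merged into one kernel-verified Lean document; each statement's English description precedes it below -/
import Mathlib

section
/- Let X and Y be independent random variables on a probability space (Ω, 𝓕, ℙ), where X has the Pareto distribution with shape a_X > 0 and scale θ_X > 0 and Y has the Pareto distribution with shape a_Y > 0 and scale θ_Y > 0, and suppose a_X ≠ a_Y. Then the product Z = X·Y has probability density function f_Z(z) = a_X·a_Y·( z^{-a_X-1}·(θ_X·θ_Y)^{a_X}/(a_Y - a_X) + z^{-a_Y-1}·(θ_X·θ_Y)^{a_Y}/(a_X - a_Y) ) for z > θ_X·θ_Y, and f_Z(z) = 0 for z ≤ θ_X·θ_Y. -/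
open MeasureTheory ProbabilityTheory Real

/-- The Pareto probability density function with shape `a` and scale `θ`. -/
noncomputable def paretoPdf (a θ x : ℝ) : ℝ :=
  if θ < x then a * θ ^ a * x ^ (-(a + 1)) else 0

/-- The law of a product of independent real random variables with densities `f` and `g` is given
by the Mellin convolution of `f` and `g`. -/
theorem map_mul_eq_withDensity_of_indepFun {Ω : Type*} [MeasurableSpace Ω] {P : Measure Ω}
    [IsProbabilityMeasure P] {X Y : Ω → ℝ} (hXm : Measurable X) (hYm : Measurable Y)
    (hindep : IndepFun X Y P) {f g : ℝ → ENNReal} (hf : Measurable f) (hg : Measurable g)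
    (hX : Measure.map X P = volume.withDensity f) (hY : Measure.map Y P = volume.withDensity g) :
    Measure.map (fun ω => X ω * Y ω) P
      = volume.withDensity (fun z => ∫⁻ x, f x * (ENNReal.ofReal |x⁻¹| * g (z / x))) := by
  have : IsProbabilityMeasure (Measure.map Y P) := Measure.isProbabilityMeasure_map hYm.aemeasurable
  have hprod : Measure.map (fun ω => (X ω, Y ω)) P = (Measure.map X P).prod (Measure.map Y P) :=
    (indepFun_iff_map_prod_eq_prod_map_map hXm.aemeasurable hYm.aemeasurable).1 hindep
  have hmap : Measure.map (fun ω => X ω * Y ω) P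
      = Measure.map (fun p : ℝ × ℝ => p.1 * p.2) ((Measure.map X P).prod (Measure.map Y P)) := by
    rw [← hprod, Measure.map_map (by fun_prop) (by fun_prop)]
    rfl
  have hscale : ∀ s : Set ℝ, MeasurableSet s → ∀ x : ℝ, x ≠ 0 →
      Measure.map Y P ((fun y => x * y) ⁻¹' s)
        = ∫⁻ z in s, ENNReal.ofReal |x⁻¹| * g (z / x) := by
    intro s hs x hx
    have hsx : MeasurableSet ((fun y => x * y) ⁻¹' s) := hs.preimage (by fun_prop)
    have hgx : Measurable fun z => g (z / x) := by fun_prop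
    rw [lintegral_const_mul _ hgx, hY, withDensity_apply _ hsx, ← smul_eq_mul,
      ← lintegral_smul_measure, ← Measure.restrict_smul, ← Real.map_volume_mul_left hx,
      setLIntegral_map hs hgx (by fun_prop)]
    simp [mul_div_cancel_left₀ _ hx]
  ext s hs
  rw [hmap, Measure.map_apply (by fun_prop) hs, Measure.prod_apply (hs.preimage (by fun_prop)), hX,
    lintegral_withDensity_eq_lintegral_mul _ hf
      (measurable_measure_prodMk_left (hs.preimage (by fun_prop))),
    withDensity_apply _ hs, lintegral_lintegral_swap (by fun_prop)]
  refine lintegral_congr_ae ?_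
  filter_upwards [volume.ae_ne (0 : ℝ)] with x hx
  rw [lintegral_const_mul _ (by fun_prop), Pi.mul_apply, ← hscale s hs x hx]
  rfl

theorem measurable_paretoPdf (a θ : ℝ) : Measurable (paretoPdf a θ) :=
  Measurable.ite measurableSet_Ioi (by fun_prop) measurable_const

/-- The Mellin convolution of two Pareto densities with distinct shapes. -/
theorem lintegral_paretoPdf_mul_paretoPdf_div {a b θ η : ℝ} (ha : 0 < a) (hb : 0 < b)
    (hθ : 0 < θ) (hη : 0 < η) (hne : a ≠ b) (z : ℝ) :
    ∫⁻ x, ENNReal.ofReal (paretoPdf a θ x)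
        * (ENNReal.ofReal |x⁻¹| * ENNReal.ofReal (paretoPdf b η (z / x)))
      = ENNReal.ofReal (if θ * η < z then
          a * b * (z ^ (-a - 1) * (θ * η) ^ a / (b - a) + z ^ (-b - 1) * (θ * η) ^ b / (a - b))
        else 0) := by
  have hind : ∀ x, ENNReal.ofReal (paretoPdf a θ x)
        * (ENNReal.ofReal |x⁻¹| * ENNReal.ofReal (paretoPdf b η (z / x)))
      = (Set.Ioo θ (z / η)).indicator (fun x => ENNReal.ofReal
          (a * θ ^ a * (b * η ^ b) * z ^ (-(b + 1)) * x ^ (b - a - 1))) x := by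
    intro x
    by_cases hx : θ < x
    · have hx0 : 0 < x := hθ.trans hx
      have hiff : η < z / x ↔ x < z / η := by rw [lt_div_iff₀ hx0, lt_div_iff₀ hη, mul_comm]
      by_cases hxz : x < z / η
      · have hz : 0 < z := (mul_pos hx0 hη).trans ((lt_div_iff₀ hη).1 hxz)
        rw [Set.indicator_of_mem (Set.mem_Ioo.2 ⟨hx, hxz⟩), paretoPdf, paretoPdf, if_pos hx,
          if_pos (hiff.2 hxz), ← ENNReal.ofReal_mul (abs_nonneg _),
          ← ENNReal.ofReal_mul (by positivity), abs_of_pos (inv_pos.2 hx0),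
          div_rpow hz.le hx0.le]
        have hpow : x ^ (b - a - 1) = x ^ (-(a + 1)) * x⁻¹ * (x ^ (-(b + 1)))⁻¹ := by
          rw [← rpow_neg hx0.le, ← rpow_neg_one, ← rpow_add hx0, ← rpow_add hx0]
          ring_nf
        rw [hpow]
        congr 1
        ring
      · rw [Set.indicator_of_notMem (fun h => hxz h.2), paretoPdf, paretoPdf,
          if_neg (mt hiff.1 hxz)]
        simp
    · rw [Set.indicator_of_notMem (fun h => hx h.1), paretoPdf, if_neg hx]
      simp
  rw [lintegral_congr hind, lintegral_indicator measurableSet_Ioo]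
  split_ifs with hz
  · have hz0 : 0 < z := (mul_pos hθ hη).trans hz
    have hle : θ ≤ z / η := ((lt_div_iff₀ hη).2 hz).le
    have h0 : (0 : ℝ) ∉ Set.uIcc θ (z / η) := by
      rw [Set.uIcc_of_le hle]
      exact fun h => hθ.not_ge h.1
    have hba : b - a ≠ 0 := sub_ne_zero.2 hne.symm
    have hint : IntervalIntegrable
        (fun x => a * θ ^ a * (b * η ^ b) * z ^ (-(b + 1)) * x ^ (b - a - 1)) volume θ (z / η) :=
      (intervalIntegral.intervalIntegrable_rpow (Or.inr h0)).const_mul _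
    have hnn : 0 ≤ᵐ[volume.restrict (Set.Ioc θ (z / η))]
        fun x => a * θ ^ a * (b * η ^ b) * z ^ (-(b + 1)) * x ^ (b - a - 1) := by
      filter_upwards [ae_restrict_mem measurableSet_Ioc] with x hx
      have : 0 < x := hθ.trans hx.1
      simp only [Pi.zero_apply]
      positivity
    rw [setLIntegral_congr Ioo_ae_eq_Ioc, ← ofReal_integral_eq_lintegral_ofReal
      ((intervalIntegrable_iff_integrableOn_Ioc_of_le hle).1 hint) hnn,
      ← intervalIntegral.integral_of_le hle, intervalIntegral.integral_const_mul,
      integral_rpow (Or.inr ⟨fun h => hba (by linarith), h0⟩)]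
    congr 1
    rw [sub_add_cancel, div_rpow hz0.le hη.le, mul_rpow hθ.le hη.le, mul_rpow hθ.le hη.le,
      rpow_sub hz0, rpow_sub hη, rpow_sub hθ, rpow_sub hz0, rpow_sub hz0, neg_add', rpow_sub hz0,
      rpow_neg hz0.le, rpow_neg hz0.le]
    rw [← neg_sub b a, div_neg]
    field_simp
    ring
  · have : Set.Ioo θ (z / η) = ∅ := Set.Ioo_eq_empty (mt (lt_div_iff₀ hη).1 hz)
    simp [this]

theorem product_of_independent_pareto_ne
    {Ω : Type*} [MeasurableSpace Ω] (P : Measure Ω) [IsProbabilityMeasure P]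
    (X Y : Ω → ℝ) (hXm : Measurable X) (hYm : Measurable Y)
    (hindep : IndepFun X Y P)
    (aX aY θX θY : ℝ) (haX : 0 < aX) (haY : 0 < aY) (hθX : 0 < θX) (hθY : 0 < θY)
    (hne : aX ≠ aY)
    (hX : Measure.map X P
      = (volume : Measure ℝ).withDensity (fun x => ENNReal.ofReal (paretoPdf aX θX x)))
    (hY : Measure.map Y P
      = (volume : Measure ℝ).withDensity (fun y => ENNReal.ofReal (paretoPdf aY θY y))) :
    Measure.map (fun ω => X ω * Y ω) P
      = (volume : Measure ℝ).withDensity (fun z => ENNReal.ofReal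
          (if θX * θY < z then
            aX * aY * (z ^ (-aX - 1) * (θX * θY) ^ aX / (aY - aX)
              + z ^ (-aY - 1) * (θX * θY) ^ aY / (aX - aY))
          else 0)) := by
  have hf := (measurable_paretoPdf aX θX).ennreal_ofReal
  have hg := (measurable_paretoPdf aY θY).ennreal_ofReal
  rw [map_mul_eq_withDensity_of_indepFun hXm hYm hindep hf hg hX hY]
  congr 1 with z
  exact lintegral_paretoPdf_mul_paretoPdf_div haX haY hθX hθY hne z
end

section
/- Let X and Y be independent random variables on a probability space (Ω, 𝓕, ℙ), where X has the centered Gaussian distribution with standard deviation σ > 0 and Y has the Pareto distribution with shape a > 0 and scale θ > 0. Then for every z > 0, ℙ(X·Y ≤ z) = Φ_σ(z/θ) − ( θ^a / (√(2π)·σ·z^a) ) · ∫₀^{z/θ} x^a·exp(−x²/(2σ²)) dx, where Φ_σ(t) = (1/(√(2π)·σ))·∫_{−∞}^{t} exp(−u²/(2σ²)) du is the cumulative distribution function of the centered Gaussian distribution with standard deviation σ. -/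
open MeasureTheory ProbabilityTheory Real

/-- The centered Gaussian probability density function with standard deviation `σ`. -/
noncomputable def gaussPdf (σ x : ℝ) : ℝ :=
  (1 / (Real.sqrt (2 * π) * σ)) * Real.exp (-x ^ 2 / (2 * σ ^ 2))

/-- The centered Gaussian cumulative distribution function with standard deviation `σ`. -/
noncomputable def gaussCdf (σ t : ℝ) : ℝ :=
  (1 / (Real.sqrt (2 * π) * σ)) * ∫ u in Set.Iic t, Real.exp (-u ^ 2 / (2 * σ ^ 2))

theorem gaussPdf_nonneg {σ : ℝ} (hσ : 0 < σ) (x : ℝ) : 0 ≤ gaussPdf σ x := by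
  unfold gaussPdf
  positivity

theorem integrable_gaussPdf {σ : ℝ} (hσ : 0 < σ) : Integrable (gaussPdf σ) := by
  have h := (integrable_exp_neg_mul_sq (b := 1 / (2 * σ ^ 2)) (by positivity)).const_mul
    (1 / (Real.sqrt (2 * π) * σ))
  convert h using 2 with x
  unfold gaussPdf
  congr 2
  ring

/-- The survival function of the Pareto distribution above its scale. -/
theorem withDensity_paretoPdf_Ioi {a θ t : ℝ} (ha : 0 < a) (hθ : 0 < θ) (ht : θ ≤ t) :
    ((volume : Measure ℝ).withDensity fun y => ENNReal.ofReal (paretoPdf a θ y)).real (Set.Ioi t)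
      = (θ / t) ^ a := by
  have ht0 : 0 < t := hθ.trans_le ht
  have hcongr : ∫⁻ y in Set.Ioi t, ENNReal.ofReal (paretoPdf a θ y)
      = ∫⁻ y in Set.Ioi t, ENNReal.ofReal (a * θ ^ a * y ^ (-(a + 1))) := by
    refine setLIntegral_congr_fun measurableSet_Ioi fun y hy => ?_
    simp only [paretoPdf, if_pos (ht.trans_lt hy)]
  have hint : IntegrableOn (fun y : ℝ => a * θ ^ a * y ^ (-(a + 1))) (Set.Ioi t) :=
    (integrableOn_Ioi_rpow_of_lt (by linarith) ht0).const_mul _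
  have hnn : 0 ≤ᵐ[volume.restrict (Set.Ioi t)] fun y : ℝ => a * θ ^ a * y ^ (-(a + 1)) := by
    filter_upwards [ae_restrict_mem measurableSet_Ioi] with y hy
    have : 0 < y := ht0.trans hy
    positivity
  rw [Measure.real, withDensity_apply _ measurableSet_Ioi, hcongr,
    ← ofReal_integral_eq_lintegral_ofReal hint hnn, ENNReal.toReal_ofReal (integral_nonneg_of_ae hnn),
    integral_const_mul, integral_Ioi_rpow_of_lt (by linarith) ht0, Real.div_rpow hθ.le ht0.le,
    show -(a + 1) + 1 = -a by ring, Real.rpow_neg ht0.le]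
  field_simp

/-- The cumulative distribution function of a multiple of a Pareto random variable, as a function
of the multiplier. -/
theorem pareto_real_mul_le {a θ z : ℝ} (ha : 0 < a) (hθ : 0 < θ) (hz : 0 < z) (x : ℝ)
    [IsProbabilityMeasure
      ((volume : Measure ℝ).withDensity fun y => ENNReal.ofReal (paretoPdf a θ y))] :
    ((volume : Measure ℝ).withDensity fun y => ENNReal.ofReal (paretoPdf a θ y)).real
        {y | x * y ≤ z}
      = (Set.Iic (z / θ)).indicator 1 x
        - (Set.Ioc 0 (z / θ)).indicator (fun x => (θ * x / z) ^ a) x := by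
  set ν := (volume : Measure ℝ).withDensity fun y => ENNReal.ofReal (paretoPdf a θ y)
  have htail {t : ℝ} (ht : θ ≤ t) : ν.real (Set.Ioi t) = (θ / t) ^ a :=
    withDensity_paretoPdf_Ioi ha hθ ht
  have hcdf {t : ℝ} (ht : θ ≤ t) : ν.real (Set.Iic t) = 1 - (θ / t) ^ a := by
    rw [← Set.compl_Ioi, probReal_compl_eq_one_sub measurableSet_Ioi, htail ht]
  have hone : (θ / θ) ^ a = 1 := by rw [div_self hθ.ne', Real.one_rpow]
  rcases le_or_gt x 0 with hx | hx
  · have hsub : Set.Ioi θ ⊆ {y | x * y ≤ z} := fun y hy =>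
      (mul_nonpos_of_nonpos_of_nonneg hx (hθ.trans hy).le).trans hz.le
    have h1 : ν.real {y | x * y ≤ z} = 1 := by
      refine le_antisymm measureReal_le_one ?_
      calc (1 : ℝ) = ν.real (Set.Ioi θ) := by rw [htail le_rfl, hone]
        _ ≤ _ := measureReal_mono hsub
    have hxc : x ∈ Set.Iic (z / θ) := hx.trans (by positivity)
    have hx0 : x ∉ Set.Ioc 0 (z / θ) := fun h => hx.not_gt h.1
    simp [h1, Set.indicator_of_mem hxc, Set.indicator_of_notMem hx0]
  · have hset : {y | x * y ≤ z} = Set.Iic (z / x) := by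
      ext y
      simp [le_div_iff₀ hx, mul_comm]
    rw [hset]
    rcases le_or_gt x (z / θ) with hxc | hxc
    · have ht : θ ≤ z / x := by
        rw [le_div_iff₀ hθ] at hxc
        rw [le_div_iff₀ hx]
        linarith
      have hm : x ∈ Set.Iic (z / θ) := hxc
      have hm0 : x ∈ Set.Ioc 0 (z / θ) := ⟨hx, hxc⟩
      rw [hcdf ht, Set.indicator_of_mem hm, Set.indicator_of_mem hm0, div_div_eq_mul_div]
      rfl
    · have ht : z / x ≤ θ := by
        rw [div_lt_iff₀ hθ] at hxc
        rw [div_le_iff₀ hx]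
        linarith
      have h0 : ν.real (Set.Iic (z / x)) = 0 := by
        refine le_antisymm ?_ measureReal_nonneg
        calc ν.real (Set.Iic (z / x)) ≤ ν.real (Set.Iic θ) :=
              measureReal_mono (Set.Iic_subset_Iic.2 ht)
          _ = 0 := by rw [hcdf le_rfl, hone, sub_self]
      have hm : x ∉ Set.Iic (z / θ) := hxc.not_ge
      have hm0 : x ∉ Set.Ioc 0 (z / θ) := fun h => hm h.2
      simp [h0, Set.indicator_of_notMem hm, Set.indicator_of_notMem hm0]

theorem product_of_gaussian_pareto_cdf
    {Ω : Type*} [MeasurableSpace Ω] (P : Measure Ω) [IsProbabilityMeasure P]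
    (X Y : Ω → ℝ) (hXm : Measurable X) (hYm : Measurable Y)
    (hindep : IndepFun X Y P)
    (a θ σ : ℝ) (ha : 0 < a) (hθ : 0 < θ) (hσ : 0 < σ)
    (hX : Measure.map X P
      = (volume : Measure ℝ).withDensity (fun x => ENNReal.ofReal (gaussPdf σ x)))
    (hY : Measure.map Y P
      = (volume : Measure ℝ).withDensity (fun y => ENNReal.ofReal (paretoPdf a θ y))) :
    ∀ z : ℝ, 0 < z →
      (P {ω | X ω * Y ω ≤ z}).toReal
        = gaussCdf σ (z / θ)
          - (θ ^ a / (Real.sqrt (2 * π) * σ * z ^ a))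
              * ∫ x in (0:ℝ)..(z / θ), x ^ a * Real.exp (-x ^ 2 / (2 * σ ^ 2)) := by
  intro z hz
  have hc : 0 < z / θ := by positivity
  have := Measure.isProbabilityMeasure_map (μ := P) hYm.aemeasurable
  have hprod := hindep.map_prod_eq_prod_map_map hXm.aemeasurable hYm.aemeasurable
  have hS : MeasurableSet {p : ℝ × ℝ | p.1 * p.2 ≤ z} :=
    measurableSet_le (by fun_prop) measurable_const
  have hpre : P {ω | X ω * Y ω ≤ z}
      = ∫⁻ x, (P.map Y) {y | x * y ≤ z} ∂(P.map X) := by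
    have h := congrArg (fun m => m {p : ℝ × ℝ | p.1 * p.2 ≤ z}) hprod
    simp only [Measure.map_apply (hXm.prodMk hYm) hS, Measure.prod_apply hS] at h
    exact h
  have hsec : Measurable fun x => (P.map Y) {y | x * y ≤ z} := measurable_measure_prodMk_left hS
  rw [hpre, ← integral_toReal hsec.aemeasurable (ae_of_all _ fun x => measure_lt_top _ _)]
  rw [hY] at this ⊢
  have hmeas : Measurable (gaussPdf σ) := by
    unfold gaussPdf
    fun_prop
  rw [hX, integral_withDensity_eq_integral_toReal_smul hmeas.ennreal_ofReal
    (ae_of_all _ fun x => ENNReal.ofReal_lt_top)]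
  set K : ℝ := θ ^ a / (Real.sqrt (2 * π) * σ * z ^ a) with hK
  set f : ℝ → ℝ := fun x => x ^ a * Real.exp (-x ^ 2 / (2 * σ ^ 2)) with hf
  have hpt (x : ℝ) : (ENNReal.ofReal (gaussPdf σ x)).toReal •
      (((volume : Measure ℝ).withDensity fun y => ENNReal.ofReal (paretoPdf a θ y))
        {y | x * y ≤ z}).toReal
      = (Set.Iic (z / θ)).indicator (gaussPdf σ) x
        - (Set.Ioc 0 (z / θ)).indicator (fun x => K * f x) x := by
    have h := pareto_real_mul_le ha hθ hz x
    rw [Measure.real] at h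
    rw [h, ENNReal.toReal_ofReal (gaussPdf_nonneg hσ x), smul_eq_mul, mul_sub]
    congr 1
    · by_cases hx : x ∈ Set.Iic (z / θ) <;> simp only [Set.indicator, hx] <;> simp
    · by_cases hx : x ∈ Set.Ioc 0 (z / θ)
      · rw [Set.indicator_of_mem hx, Set.indicator_of_mem hx, hK, hf, gaussPdf,
          Real.div_rpow (mul_nonneg hθ.le hx.1.le) hz.le, Real.mul_rpow hθ.le hx.1.le]
        field_simp
      · simp [Set.indicator_of_notMem hx]
  have hfc : Continuous f :=
    (Real.continuous_rpow_const ha.le).mul (by fun_prop)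
  have hfi : IntegrableOn (fun x => K * f x) (Set.Ioc 0 (z / θ)) :=
    ((hfc.const_mul K).integrableOn_Icc).mono_set Set.Ioc_subset_Icc_self
  simp_rw [hpt]
  rw [integral_sub ((integrable_gaussPdf hσ).indicator measurableSet_Iic)
      (hfi.integrable_indicator measurableSet_Ioc),
    integral_indicator measurableSet_Iic, integral_indicator measurableSet_Ioc,
    integral_const_mul, intervalIntegral.integral_of_le hc.le]
  simp only [gaussPdf, gaussCdf, integral_const_mul, hf]
end

section
/- Let G₁ and G₂ be independent standard Gaussian random variables on a probability space (Ω, 𝓕, ℙ), let μ_X, μ_Y ∈ ℝ, σ_X, σ_Y > 0, ρ ∈ (−1, 1), and define X = μ_X + σ_X·G₁ and Y = μ_Y + σ_Y·(ρ·G₁ + √(1−ρ²)·G₂) (so that (X, Y) is bivariate Gaussian with means μ_X, μ_Y, standard deviations σ_X, σ_Y and correlation ρ). Then the variance of the product Z = X·Y equals Var(Z) = σ_X²·μ_Y² + σ_Y²·μ_X² + σ_X²·σ_Y² + 2ρ·μ_X·μ_Y·σ_X·σ_Y + ρ²·σ_X²·σ_Y². -/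
open MeasureTheory ProbabilityTheory Real

/-- The standard Gaussian probability density function. -/
noncomputable def stdGaussPdf (u : ℝ) : ℝ :=
  (1 / Real.sqrt (2 * π)) * Real.exp (-u ^ 2 / 2)

lemma withDensity_stdGaussPdf_eq_gaussianReal :
    (volume : Measure ℝ).withDensity (fun x => ENNReal.ofReal (stdGaussPdf x))
      = gaussianReal 0 1 := by
  rw [gaussianReal_of_var_ne_zero 0 one_ne_zero]
  congr 1
  ext x
  simp [gaussianPDF, gaussianPDFReal, stdGaussPdf]

lemma iteratedDeriv_succ_of_eq_mul_exp {f p q : ℝ → ℝ} {n : ℕ}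
    (h : iteratedDeriv n f = fun t => p t * exp (t ^ 2 / 2))
    (hp : ∀ t, HasDerivAt p (q t - t * p t) t) :
    iteratedDeriv (n + 1) f = fun t => q t * exp (t ^ 2 / 2) := by
  rw [iteratedDeriv_succ, h]
  ext t
  have he : HasDerivAt (fun t : ℝ => exp (t ^ 2 / 2)) (exp (t ^ 2 / 2) * t) t := by
    refine ((hasDerivAt_pow 2 t).div_const 2).exp.congr_deriv ?_
    push_cast
    ring
  refine ((hp t).mul he).deriv.trans ?_
  ring

lemma moments_gaussianReal_zero_one :
    (∫ x, x ∂gaussianReal 0 1 = 0) ∧ (∫ x, x ^ 2 ∂gaussianReal 0 1 = 1) ∧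
      (∫ x, x ^ 3 ∂gaussianReal 0 1 = 0) ∧ (∫ x, x ^ 4 ∂gaussianReal 0 1 = 3) := by
  have hmom (n : ℕ) : ∫ x, x ^ n ∂gaussianReal 0 1
      = iteratedDeriv n (fun t : ℝ => exp (t ^ 2 / 2)) 0 := by
    have h := iteratedDeriv_mgf_zero (X := id) (μ := gaussianReal 0 1) (by simp) n
    rw [mgf_id_gaussianReal] at h
    simpa using h.symm
  have h0 : iteratedDeriv 0 (fun t : ℝ => exp (t ^ 2 / 2))
      = fun t => 1 * exp (t ^ 2 / 2) := by simp
  have h1 := iteratedDeriv_succ_of_eq_mul_exp (q := fun t => t) h0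
    fun t => by simpa using hasDerivAt_const t (1 : ℝ)
  have h2 := iteratedDeriv_succ_of_eq_mul_exp (q := fun t => 1 + t ^ 2) h1
    fun t => (hasDerivAt_id' t).congr_deriv (by ring)
  have h3 := iteratedDeriv_succ_of_eq_mul_exp (q := fun t => 3 * t + t ^ 3) h2
    fun t => ((hasDerivAt_pow 2 t).const_add 1).congr_deriv (by push_cast; ring)
  have h4 := iteratedDeriv_succ_of_eq_mul_exp (q := fun t => 3 + 6 * t ^ 2 + t ^ 4) h3
    fun t => 
      (((hasDerivAt_id' t).const_mul 3).add (hasDerivAt_pow 3 t)).congr_deriv (by push_cast; ring)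
  refine ⟨integral_id_gaussianReal, ?_, ?_, ?_⟩
  · rw [hmom, h2]; simp
  · rw [hmom, h3]; simp
  · rw [hmom, h4]; simp

lemma integrable_pow_of_map_eq_gaussianReal {Ω : Type*} [MeasurableSpace Ω] {P : Measure Ω}
    {G : Ω → ℝ} (hG : Measurable G) {μ : ℝ} {v : NNReal} (hmap : P.map G = gaussianReal μ v)
    (n : ℕ) : Integrable (fun ω => G ω ^ n) P := by
  have h : Integrable (fun x : ℝ => x ^ n) (P.map G) := by
    rw [hmap]
    rcases Nat.eq_zero_or_pos n with rfl | hn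
    · simp
    · have := (memLp_id_gaussianReal (μ := μ) (v := v) n).integrable_norm_pow hn.ne'
      refine this.mono (by fun_prop) (by simp)
  exact h.comp_measurable hG

lemma ProbabilityTheory.IndepFun.integrable_pow_mul_pow {Ω : Type*} [MeasurableSpace Ω]
    {P : Measure Ω} {G H : Ω → ℝ} (hindep : IndepFun G H P)
    (hGi : ∀ n : ℕ, Integrable (fun ω => G ω ^ n) P)
    (hHi : ∀ n : ℕ, Integrable (fun ω => H ω ^ n) P) (i j : ℕ) :
    Integrable (fun ω => G ω ^ i * H ω ^ j) P :=
  (hindep.comp (φ := fun x => x ^ i) (ψ := fun x => x ^ j) (by fun_prop)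
    (by fun_prop)).integrable_mul (hGi i) (hHi j)

lemma ProbabilityTheory.IndepFun.integral_sum_pow_mul_pow {Ω : Type*} [MeasurableSpace Ω]
    {P : Measure Ω} {G H : Ω → ℝ} (hindep : IndepFun G H P)
    (hGi : ∀ n : ℕ, Integrable (fun ω => G ω ^ n) P)
    (hHi : ∀ n : ℕ, Integrable (fun ω => H ω ^ n) P) {m n : ℕ} (c : Fin m → Fin n → ℝ) :
    ∫ ω, ∑ i, ∑ j, c i j * (G ω ^ (i : ℕ) * H ω ^ (j : ℕ)) ∂P
      = ∑ i, ∑ j, c i j * ((∫ ω, G ω ^ (i : ℕ) ∂P) * ∫ ω, H ω ^ (j : ℕ) ∂P) := by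
  have hint (i j : ℕ) := hindep.integrable_pow_mul_pow hGi hHi i j
  rw [integral_finsetSum _ fun (i : Fin m) _ =>
    integrable_finsetSum _ fun (j : Fin n) _ => (hint i j).const_mul (c i j)]
  refine Finset.sum_congr rfl fun i _ => ?_
  rw [integral_finsetSum _ fun (j : Fin n) _ => (hint i j).const_mul (c i j)]
  refine Finset.sum_congr rfl fun j _ => ?_
  rw [integral_const_mul]
  congr 1
  exact (hindep.comp (φ := fun x => x ^ (i : ℕ)) (ψ := fun x => x ^ (j : ℕ)) (by fun_prop)
    (by fun_prop)).integral_mul_eq_mul_integral (hGi i).aestronglyMeasurable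
    (hHi j).aestronglyMeasurable

theorem variance_of_bivariate_gaussian_product
    {Ω : Type*} [MeasurableSpace Ω] (P : Measure Ω) [IsProbabilityMeasure P]
    (G₁ G₂ : Ω → ℝ) (hG₁m : Measurable G₁) (hG₂m : Measurable G₂)
    (hindep : IndepFun G₁ G₂ P)
    (hG₁ : Measure.map G₁ P
      = (volume : Measure ℝ).withDensity (fun x => ENNReal.ofReal (stdGaussPdf x)))
    (hG₂ : Measure.map G₂ P
      = (volume : Measure ℝ).withDensity (fun x => ENNReal.ofReal (stdGaussPdf x)))
    (μX μY σX σY ρ : ℝ) (hσX : 0 < σX) (hσY : 0 < σY) (hρ : ρ ∈ Set.Ioo (-1 : ℝ) 1)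
    (X Y : Ω → ℝ)
    (hXdef : ∀ ω, X ω = μX + σX * G₁ ω)
    (hYdef : ∀ ω, Y ω = μY + σY * (ρ * G₁ ω + Real.sqrt (1 - ρ ^ 2) * G₂ ω)) :
    ProbabilityTheory.variance (fun ω => X ω * Y ω) P
      = σX ^ 2 * μY ^ 2 + σY ^ 2 * μX ^ 2 + σX ^ 2 * σY ^ 2
        + 2 * ρ * μX * μY * σX * σY + ρ ^ 2 * σX ^ 2 * σY ^ 2 := by
  rw [withDensity_stdGaussPdf_eq_gaussianReal] at hG₁ hG₂
  have hi₁ := integrable_pow_of_map_eq_gaussianReal hG₁m hG₁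
  have hi₂ := integrable_pow_of_map_eq_gaussianReal hG₂m hG₂
  obtain ⟨m1, m2, m3, m4⟩ := moments_gaussianReal_zero_one
  have hmom {G : Ω → ℝ} (hG : Measurable G) (hmap : P.map G = gaussianReal 0 1) (n : ℕ) :
      ∫ ω, G ω ^ n ∂P = ∫ x, x ^ n ∂gaussianReal 0 1 := by
    rw [← hmap, integral_map hG.aemeasurable (by fun_prop)]
  have hs : √(1 - ρ ^ 2) ^ 2 = 1 - ρ ^ 2 := Real.sq_sqrt (by nlinarith [hρ.1, hρ.2])
  set s := √(1 - ρ ^ 2)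
  obtain rfl : X = fun ω => μX + σX * G₁ ω := funext hXdef
  obtain rfl : Y = fun ω => μY + σY * (ρ * G₁ ω + s * G₂ ω) := funext hYdef
  let Z : Ω → ℝ := fun ω => (μX + σX * G₁ ω) * (μY + σY * (ρ * G₁ ω + s * G₂ ω))
  change Var[Z; P] = _
  let A := μX * μY
  let B := μX * σY * ρ + σX * μY
  let C := σX * σY * ρ
  let D := μX * σY * s
  let E := σX * σY * s
  have hZ : Z = fun ω => ∑ i, ∑ j, (![![A, D], ![B, E], ![C, 0]] : Fin 3 → Fin 2 → ℝ) i j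
        * (G₁ ω ^ (i : ℕ) * G₂ ω ^ (j : ℕ)) := by
    ext ω
    simp [Z, A, B, C, D, E, Fin.sum_univ_succ]
    ring
  have hZ2 : Z ^ 2 = fun ω => ∑ i, ∑ j, (![![A ^ 2, 2 * A * D, D ^ 2],
          ![2 * A * B, 2 * (A * E + B * D), 2 * D * E],
          ![B ^ 2 + 2 * A * C, 2 * (B * E + C * D), E ^ 2],
          ![2 * B * C, 2 * C * E, 0], ![C ^ 2, 0, 0]] : Fin 5 → Fin 3 → ℝ) i j
        * (G₁ ω ^ (i : ℕ) * G₂ ω ^ (j : ℕ)) := by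
    ext ω
    simp [Z, A, B, C, D, E, Fin.sum_univ_succ]
    ring
  have hLp : MemLp Z 2 P := by
    refine (memLp_two_iff_integrable_sq (by fun_prop)).2 ?_
    change Integrable (Z ^ 2) P
    rw [hZ2]
    exact integrable_finsetSum _ fun (i : Fin 5) _ => integrable_finsetSum _ fun (j : Fin 3) _ =>
      (hindep.integrable_pow_mul_pow hi₁ hi₂ i j).const_mul _
  rw [variance_eq_sub hLp, hZ2, hZ, hindep.integral_sum_pow_mul_pow hi₁ hi₂,
    hindep.integral_sum_pow_mul_pow hi₁ hi₂]
  simp only [hmom hG₁m hG₁, hmom hG₂m hG₂]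
  simp [A, B, C, D, E, Fin.sum_univ_succ, m1, m2, m3, m4]
  linear_combination (μX ^ 2 * σY ^ 2 + σX ^ 2 * σY ^ 2) * hs
end

section
/- Let X and Y be independent random variables on a probability space (Ω, 𝓕, ℙ), where X has the Student's t distribution with n_X > 0 degrees of freedom and Y has the Student's t distribution with n_Y > 0 degrees of freedom. Then the product Z = X·Y has probability density function f_Z(z) = ( 2·Γ((n_X+1)/2)·Γ((n_Y+1)/2) / (√(n_X·n_Y)·π·Γ(n_X/2)·Γ(n_Y/2)) ) · ∫₀^∞ (1/x)·(1 + x²/n_X)^{-(n_X+1)/2}·(1 + z²/(x²·n_Y))^{-(n_Y+1)/2} dx for every z ∈ ℝ. -/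
open MeasureTheory ProbabilityTheory Real

/-- The Student's t probability density function with `n` degrees of freedom. -/
noncomputable def studentPdf (n y : ℝ) : ℝ :=
  (Real.Gamma ((n + 1) / 2) / (Real.sqrt (n * π) * Real.Gamma (n / 2)))
    * (1 + y ^ 2 / n) ^ (-((n + 1) / 2))

/-- The integral of an even function over the line is twice its integral over the half-line. -/
lemma lintegral_eq_two_mul_setLIntegral_Ioi_of_even {f : ℝ → ENNReal}
    (hf : ∀ x, f (-x) = f x) : ∫⁻ x, f x = 2 * ∫⁻ x in Set.Ioi (0 : ℝ), f x := by
  have hneg : ∫⁻ x in Set.Iic (0 : ℝ), f x = ∫⁻ x in Set.Ioi (0 : ℝ), f x := by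
    rw [setLIntegral_congr Iio_ae_eq_Iic.symm]
    have h := (Measure.measurePreserving_neg (volume : Measure ℝ)).setLIntegral_comp_preimage_emb
      (MeasurableEquiv.neg ℝ).measurableEmbedding f (Set.Ioi 0)
    simpa [hf] using h
  rw [← lintegral_add_compl f (measurableSet_Ioi (a := (0 : ℝ))), Set.compl_Ioi, hneg, two_mul]

/-- The change of variables `z = x * y` in a Lebesgue integral. -/
lemma lintegral_eq_lintegral_comp_div (φ : ℝ → ENNReal) {x : ℝ} (hx : x ≠ 0) :
    ∫⁻ y, φ y = ∫⁻ z, φ (z / x) * ENNReal.ofReal |x⁻¹| := by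
  rw [lintegral_mul_const' _ _ ENNReal.ofReal_ne_top, mul_comm]
  conv_lhs => rw [← Real.smul_map_volume_mul_left (inv_ne_zero hx)]
  rw [lintegral_smul_measure,
    (measurableEmbedding_mulLeft₀ (inv_ne_zero hx)).lintegral_map, smul_eq_mul]
  simp only [div_eq_inv_mul]

/-- The multiplicative convolution of two absolutely continuous laws on the line. -/
lemma mconv_withDensity_real {f g : ℝ → ENNReal} (hf : Measurable f) (hg : Measurable g) :
    (volume : Measure ℝ).withDensity f ∗ₘ (volume : Measure ℝ).withDensity g
      = (volume : Measure ℝ).withDensity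
          (fun z => ∫⁻ x, f x * g (z / x) * ENNReal.ofReal |x⁻¹|) := by
  refine Measure.ext_of_lintegral _ fun φ hφ => ?_
  rw [Measure.lintegral_mconv hφ,
    lintegral_withDensity_eq_lintegral_mul _ hf (by fun_prop),
    lintegral_withDensity_eq_lintegral_mul _ (by fun_prop) hφ]
  simp only [Pi.mul_apply]
  calc
    _ = ∫⁻ x, ∫⁻ z, f x * g (z / x) * ENNReal.ofReal |x⁻¹| * φ z := by
      refine lintegral_congr_ae ?_
      filter_upwards [Measure.ae_ne volume (0 : ℝ)] with x hx
      rw [lintegral_withDensity_eq_lintegral_mul _ hg (by fun_prop),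
        lintegral_eq_lintegral_comp_div _ hx, ← lintegral_const_mul _ (by fun_prop)]
      refine lintegral_congr fun z => ?_
      simp only [Pi.mul_apply, mul_div_cancel₀ z hx]
      ring
    _ = ∫⁻ z, ∫⁻ x, f x * g (z / x) * ENNReal.ofReal |x⁻¹| * φ z :=
      lintegral_lintegral_swap (by fun_prop)
    _ = _ := lintegral_congr fun z => lintegral_mul_const _ (by fun_prop)

lemma measurable_studentPdf (n : ℝ) : Measurable (studentPdf n) := by
  unfold studentPdf
  fun_prop

lemma studentPdf_nonneg {n : ℝ} (hn : 0 < n) (y : ℝ) : 0 ≤ studentPdf n y := by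
  unfold studentPdf
  have := Real.Gamma_pos_of_pos (show 0 < (n + 1) / 2 by positivity)
  have := Real.Gamma_pos_of_pos (show 0 < n / 2 by positivity)
  positivity

lemma studentPdf_neg (n y : ℝ) : studentPdf n (-y) = studentPdf n y := by
  simp [studentPdf]

lemma two_mul_studentPdf_mul_studentPdf {a b : ℝ} (ha : 0 < a) (hb : 0 < b) (x z : ℝ) :
    2 * (studentPdf a x * studentPdf b (z / x) * x⁻¹)
      = (2 * Real.Gamma ((a + 1) / 2) * Real.Gamma ((b + 1) / 2)
            / (Real.sqrt (a * b) * π * Real.Gamma (a / 2) * Real.Gamma (b / 2)))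
          * ((1 / x) * (1 + x ^ 2 / a) ^ (-((a + 1) / 2))
            * (1 + z ^ 2 / (x ^ 2 * b)) ^ (-((b + 1) / 2))) := by
  have hs : Real.sqrt (a * b) * π = Real.sqrt (a * π) * Real.sqrt (b * π) := by
    rw [Real.sqrt_mul ha.le, Real.sqrt_mul ha.le, Real.sqrt_mul hb.le]
    nth_rewrite 1 [← Real.mul_self_sqrt pi_pos.le]
    ring
  rw [hs, studentPdf, studentPdf, div_pow, div_div]
  simp only [div_eq_mul_inv, mul_inv]
  ring

theorem product_of_independent_student
    {Ω : Type*} [MeasurableSpace Ω] (P : Measure Ω) [IsProbabilityMeasure P]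
    (X Y : Ω → ℝ) (hXm : Measurable X) (hYm : Measurable Y)
    (hindep : IndepFun X Y P)
    (nX nY : ℝ) (hnX : 0 < nX) (hnY : 0 < nY)
    (hX : Measure.map X P
      = (volume : Measure ℝ).withDensity (fun x => ENNReal.ofReal (studentPdf nX x)))
    (hY : Measure.map Y P
      = (volume : Measure ℝ).withDensity (fun y => ENNReal.ofReal (studentPdf nY y))) :
    Measure.map (fun ω => X ω * Y ω) P
      = (volume : Measure ℝ).withDensity (fun z => ENNReal.ofReal
          ((2 * Real.Gamma ((nX + 1) / 2) * Real.Gamma ((nY + 1) / 2)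
              / (Real.sqrt (nX * nY) * π * Real.Gamma (nX / 2) * Real.Gamma (nY / 2)))
            * ∫ x in Set.Ioi (0:ℝ), (1 / x)
                * (1 + x ^ 2 / nX) ^ (-((nX + 1) / 2))
                * (1 + z ^ 2 / (x ^ 2 * nY)) ^ (-((nY + 1) / 2)))) := by
  set f : ℝ → ENNReal := fun x => ENNReal.ofReal (studentPdf nX x)
  set g : ℝ → ENNReal := fun y => ENNReal.ofReal (studentPdf nY y)
  have hf : Measurable f := (measurable_studentPdf nX).ennreal_ofReal
  have hg : Measurable g := (measurable_studentPdf nY).ennreal_ofReal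
  have : IsProbabilityMeasure (P.map (fun ω => X ω * Y ω)) :=
    Measure.isProbabilityMeasure_map (by fun_prop)
  have hmap : P.map (fun ω => X ω * Y ω) = (volume : Measure ℝ).withDensity
      (fun z => ∫⁻ x, f x * g (z / x) * ENNReal.ofReal |x⁻¹|) := by
    rw [← mconv_withDensity_real hf hg, ← hX, ← hY]
    exact hindep.map_mul_eq_map_mconv_map hXm hYm
  have hfin : ∀ᵐ z, ∫⁻ x, f x * g (z / x) * ENNReal.ofReal |x⁻¹| < ⊤ := by
    refine ae_lt_top (by fun_prop) ?_
    rw [← setLIntegral_univ, ← withDensity_apply _ MeasurableSet.univ, ← hmap]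
    exact measure_ne_top _ _
  rw [hmap]
  refine withDensity_congr_ae ?_
  filter_upwards [hfin] with z hz
  rw [lintegral_eq_two_mul_setLIntegral_Ioi_of_even
    (by simp [f, g, studentPdf_neg, div_neg])] at hz ⊢
  set F : ℝ → ℝ := fun x => studentPdf nX x * studentPdf nY (z / x) * x⁻¹
  have hFnn : 0 ≤ᵐ[volume.restrict (Set.Ioi (0 : ℝ))] F := by
    filter_upwards [ae_restrict_mem measurableSet_Ioi] with x hx
    exact mul_nonneg (mul_nonneg (studentPdf_nonneg hnX _) (studentPdf_nonneg hnY _))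
      (inv_nonneg.2 (le_of_lt hx))
  have hFm : Measurable F := by
    have := measurable_studentPdf nX
    have := measurable_studentPdf nY
    fun_prop
  have hF : ∫⁻ x in Set.Ioi (0 : ℝ), f x * g (z / x) * ENNReal.ofReal |x⁻¹|
      = ∫⁻ x in Set.Ioi (0 : ℝ), ENNReal.ofReal (F x) := by
    refine setLIntegral_congr_fun measurableSet_Ioi fun x hx => ?_
    have hxpos : 0 < x := hx
    simp only [f, g, F]
    rw [abs_of_pos (inv_pos.2 hxpos), ← ENNReal.ofReal_mul (studentPdf_nonneg hnX _),
      ← ENNReal.ofReal_mul (mul_nonneg (studentPdf_nonneg hnX _) (studentPdf_nonneg hnY _))]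
  rw [hF] at hz ⊢
  have hFi : IntegrableOn F (Set.Ioi 0) :=
    (lintegral_ofReal_ne_top_iff_integrable hFm.aestronglyMeasurable hFnn).1
      (ENNReal.lt_top_of_mul_ne_top_right hz.ne two_ne_zero).ne
  rw [← ofReal_integral_eq_lintegral_ofReal hFi hFnn, ← integral_const_mul]
  simp only [← two_mul_studentPdf_mul_studentPdf hnX hnY]
  rw [integral_const_mul, ENNReal.ofReal_mul zero_le_two, ENNReal.ofReal_ofNat]
end

section
/- Let (X, Y) : Ω → ℝ² be a random vector on a probability space (Ω, 𝓕, ℙ) whose law has density f_{X,Y}(x, y) = a·(a+1)·(θ_X·θ_Y)^{a+1} / (x·θ_Y + y·θ_X − θ_X·θ_Y)^{a+2} for x > θ_X and y > θ_Y (and 0 otherwise) with respect to Lebesgue measure on ℝ², where a, θ_X, θ_Y > 0 (the bivariate Pareto distribution). Then the product Z = X·Y has probability density function f_Z(z) = a·(a+1)·(θ_X·θ_Y)^{a+1} · ∫_{θ_X}^{z/θ_Y} (1/x)·( θ_Y·x + θ_X·(z/x) − θ_X·θ_Y )^{-a-2} dx for z > θ_X·θ_Y, and f_Z(z) = 0 for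 z ≤ θ_X·θ_Y. -/
open MeasureTheory ProbabilityTheory Real

/-- The bivariate Pareto probability density function. -/
noncomputable def bivParetoPdf (a θX θY x y : ℝ) : ℝ :=
  if θX < x ∧ θY < y then
    a * (a + 1) * (θX * θY) ^ (a + 1) / (x * θY + y * θX - θX * θY) ^ (a + 2)
  else 0

/-- The law of the product of the coordinates under a measure on the plane with density `f`. -/
theorem map_mul_withDensity_prod {f : ℝ × ℝ → ENNReal} (hf : Measurable f) :
    Measure.map (fun p : ℝ × ℝ => p.1 * p.2) ((volume : Measure (ℝ × ℝ)).withDensity f)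
      = (volume : Measure ℝ).withDensity
          (fun z => ∫⁻ x, ENNReal.ofReal |x⁻¹| * f (x, z / x)) := by
  ext S hS
  have hmul : Measurable fun p : ℝ × ℝ => p.1 * p.2 := by fun_prop
  have hind : Measurable (S.indicator (1 : ℝ → ENNReal)) := measurable_one.indicator hS
  have hG : Measurable fun p : ℝ × ℝ =>
      S.indicator (1 : ℝ → ENNReal) p.2 * f (p.1, p.2 / p.1) := by fun_prop
  have hscale : ∀ᵐ x : ℝ, ∫⁻ y, S.indicator (1 : ℝ → ENNReal) (x * y) * f (x, y)
      = ∫⁻ z, ENNReal.ofReal |x⁻¹| * (S.indicator (1 : ℝ → ENNReal) z * f (x, z / x)) := by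
    filter_upwards [Measure.ae_ne volume (0 : ℝ)] with x hx
    have hGx : Measurable fun z : ℝ => S.indicator (1 : ℝ → ENNReal) z * f (x, z / x) :=
      hG.comp measurable_prodMk_left
    rw [lintegral_const_mul _ hGx, ← smul_eq_mul, ← lintegral_smul_measure,
      ← Real.map_volume_mul_left hx, lintegral_map hGx (by fun_prop)]
    simp only [mul_div_cancel_left₀ _ hx]
  calc Measure.map (fun p : ℝ × ℝ => p.1 * p.2) (volume.withDensity f) S
      = ∫⁻ p : ℝ × ℝ, S.indicator (1 : ℝ → ENNReal) (p.1 * p.2) * f p := by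
        rw [Measure.map_apply hmul hS, withDensity_apply _ (hmul hS),
          ← lintegral_indicator (hmul hS)]
        refine lintegral_congr fun p => ?_
        by_cases h : p.1 * p.2 ∈ S <;> simp [Set.indicator, h]
    _ = ∫⁻ x, ∫⁻ y, S.indicator (1 : ℝ → ENNReal) (x * y) * f (x, y) := by
        rw [Measure.volume_eq_prod, lintegral_prod _ (by fun_prop)]
    _ = ∫⁻ x, ∫⁻ z, ENNReal.ofReal |x⁻¹| *
          (S.indicator (1 : ℝ → ENNReal) z * f (x, z / x)) := lintegral_congr_ae hscale
    _ = ∫⁻ z, ∫⁻ x, ENNReal.ofReal |x⁻¹| *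
          (S.indicator (1 : ℝ → ENNReal) z * f (x, z / x)) :=
        lintegral_lintegral_swap (by simp only [Function.uncurry_def]; fun_prop)
    _ = volume.withDensity (fun z => ∫⁻ x, ENNReal.ofReal |x⁻¹| * f (x, z / x)) S := by
        rw [withDensity_apply _ hS, ← lintegral_indicator hS]
        refine lintegral_congr fun z => ?_
        by_cases h : z ∈ S <;> simp [Set.indicator, h]

theorem measurable_bivParetoPdf (a θX θY : ℝ) :
    Measurable fun p : ℝ × ℝ => bivParetoPdf a θX θY p.1 p.2 := by
  unfold bivParetoPdf
  refine Measurable.ite ?_ (by fun_prop) measurable_const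
  exact (measurableSet_lt measurable_const measurable_fst).inter
    (measurableSet_lt measurable_const measurable_snd)

/-- The fibre integral of the bivariate Pareto density along the hyperbola `x * y = z`. -/
theorem lintegral_bivParetoPdf_hyperbola {a θX θY : ℝ} (ha : 0 < a) (hθX : 0 < θX)
    (hθY : 0 < θY) (z : ℝ) :
    ∫⁻ x, ENNReal.ofReal |x⁻¹| * ENNReal.ofReal (bivParetoPdf a θX θY x (z / x))
      = ENNReal.ofReal
          (if θX * θY < z then
            a * (a + 1) * (θX * θY) ^ (a + 1)
              * ∫ x in θX..(z / θY), (1 / x)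
                  * (θY * x + θX * (z / x) - θX * θY) ^ (-a - 2)
          else 0) := by
  split_ifs with hz
  · have hzpos : 0 < z := (mul_pos hθX hθY).trans hz
    have hle : θX ≤ z / θY := ((lt_div_iff₀ hθY).2 hz).le
    have hbase : ∀ x, θX ≤ x → 0 < θY * x + θX * (z / x) - θX * θY := fun x hx => by
      have h1 : 0 < θX * (z / x) := mul_pos hθX (div_pos hzpos (hθX.trans_le hx))
      nlinarith
    set C := a * (a + 1) * (θX * θY) ^ (a + 1)
    have hC : 0 ≤ C := by positivity
    set g : ℝ → ℝ := fun x => C * ((1 / x) * (θY * x + θX * (z / x) - θX * θY) ^ (-a - 2))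
      with hg
    have hg0 : ∀ x, θX ≤ x → 0 ≤ g x := fun x hx =>
      mul_nonneg hC (mul_nonneg (one_div_nonneg.2 (hθX.le.trans hx))
        (Real.rpow_nonneg (hbase x hx).le _))
    have hcont : ContinuousOn g (Set.Icc θX (z / θY)) := by
      have hne : ∀ x ∈ Set.Icc θX (z / θY), x ≠ 0 := fun x hx => (hθX.trans_le hx.1).ne'
      have hdiv : ∀ c : ℝ, ContinuousOn (fun x => c / x) (Set.Icc θX (z / θY)) := fun c =>
        continuousOn_const.div continuousOn_id hne
      refine continuousOn_const.mul ((hdiv 1).mul (ContinuousOn.rpow_const ?_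
        fun x hx => Or.inl (hbase x hx.1).ne'))
      exact ((continuousOn_const.mul continuousOn_id).add
        (continuousOn_const.mul (hdiv z))).sub continuousOn_const
    have hint : IntegrableOn g (Set.Ioo θX (z / θY)) :=
      hcont.integrableOn_Icc.mono_set Set.Ioo_subset_Icc_self
    rw [← intervalIntegral.integral_const_mul, intervalIntegral.integral_of_le hle,
      integral_Ioc_eq_integral_Ioo, ofReal_integral_eq_lintegral_ofReal hint
        (ae_restrict_of_forall_mem measurableSet_Ioo fun x hx => hg0 x hx.1.le),
      ← lintegral_indicator measurableSet_Ioo]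
    refine lintegral_congr fun x => ?_
    by_cases hx : x ∈ Set.Ioo θX (z / θY)
    · have hx0 : 0 < x := hθX.trans hx.1
      have hy : θY < z / x := by
        rw [lt_div_iff₀ hx0, mul_comm]
        exact (lt_div_iff₀ hθY).1 hx.2
      rw [Set.indicator_of_mem hx, ← ENNReal.ofReal_mul (abs_nonneg _), bivParetoPdf,
        if_pos ⟨hx.1, hy⟩, abs_of_pos (inv_pos.2 hx0)]
      congr 1
      rw [hg]
      dsimp only
      rw [show -a - 2 = -(a + 2) by ring, Real.rpow_neg (hbase x hx.1.le).le,
        mul_comm θY x, mul_comm θX (z / x)]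
      simp only [div_eq_mul_inv, one_mul]
      ring
    · rw [Set.indicator_of_notMem hx, bivParetoPdf, if_neg]
      · simp
      · rintro ⟨h1, h2⟩
        refine hx ⟨h1, (lt_div_iff₀ hθY).2 ?_⟩
        rw [mul_comm]
        exact (lt_div_iff₀ (hθX.trans h1)).1 h2
  · rw [ENNReal.ofReal_zero, lintegral_eq_zero_of_ae_eq_zero]
    refine Filter.Eventually.of_forall fun x => ?_
    have hneg : ¬(θX < x ∧ θY < z / x) := by
      rintro ⟨h1, h2⟩
      have h3 := (lt_div_iff₀ (hθX.trans h1)).1 h2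
      nlinarith
    simp [bivParetoPdf, if_neg hneg]

theorem product_of_bivariate_pareto
    {Ω : Type*} [MeasurableSpace Ω] (P : Measure Ω) [IsProbabilityMeasure P]
    (V : Ω → ℝ × ℝ) (hVm : Measurable V)
    (a θX θY : ℝ) (ha : 0 < a) (hθX : 0 < θX) (hθY : 0 < θY)
    (hV : Measure.map V P
      = (volume : Measure (ℝ × ℝ)).withDensity
          (fun p => ENNReal.ofReal (bivParetoPdf a θX θY p.1 p.2))) :
    Measure.map (fun ω => (V ω).1 * (V ω).2) P
      = (volume : Measure ℝ).withDensity (fun z => ENNReal.ofReal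
          (if θX * θY < z then
            a * (a + 1) * (θX * θY) ^ (a + 1)
              * ∫ x in θX..(z / θY), (1 / x)
                  * (θY * x + θX * (z / x) - θX * θY) ^ (-a - 2)
          else 0)) := by
  have hcomp : Measure.map (fun ω => (V ω).1 * (V ω).2) P
      = Measure.map (fun p : ℝ × ℝ => p.1 * p.2) (Measure.map V P) :=
    (Measure.map_map (measurable_fst.mul measurable_snd) hVm).symm
  rw [hcomp, hV, map_mul_withDensity_prod (measurable_bivParetoPdf a θX θY).ennreal_ofReal]
  simp only [lintegral_bivParetoPdf_hyperbola ha hθX hθY]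
end
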